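/- Let R be a semi-local ring (i.e., R/J(R) is a semisimple ring). Then R is a GWNC ring if and only if one of the following holds: (a) R is a local ring with nil Jacobson radical; (b) R/J(R) is isomorphic to the 2 × 2 matrix ring M₂(ℤ/3ℤ) and J(R) is nil; (c) R/J(R) is isomorphic to (ℤ/3ℤ) × (ℤ/3ℤ) and J(R) is nil; or (d) R is a weakly nil-clean ring. -/

import Mathlib

def IsWeaklyNilCleanElem {R : Type*} [Ring R] (a : R) : Prop :=
  ∃ e q : R, IsIdempotentElem e ∧ IsNilpotent q ∧ (a = q + e ∨ a = q - e)

def IsGWNCRing (R : Type*) [Ring R] : Prop :=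
  ∀ a : R, ¬IsUnit a → IsWeaklyNilCleanElem a

def IsWeaklyNilCleanRing (R : Type*) [Ring R] : Prop :=
  ∀ a : R, IsWeaklyNilCleanElem a

section

open Polynomial Module

/-- An element is nil-clean if it is the sum of a nilpotent and an idempotent. -/
def IsNilCleanElem {R : Type*} [Ring R] (a : R) : Prop :=
  ∃ e q : R, IsIdempotentElem e ∧ IsNilpotent q ∧ a = q + e

theorem isNilCleanElem_of_basis_hessenberg {K V : Type*} [Field K] [AddCommGroup V] [Module K V]
    {m : ℕ} (b : Basis (Fin (m + 1)) K V) (a : End K V) (d : Fin m → K)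
    (hd : ∀ i, d i * d i = d i)
    (ha : ∀ i : Fin m, a (b i.castSucc) = b i.succ + d i • b i.castSucc)
    (hlast : b.repr (a (b (Fin.last m))) (Fin.last m) = 1)
    (hc : ∀ i : Fin m, b.repr (a (b (Fin.last m))) i.castSucc * d i = 0) :
    IsNilCleanElem a := by
  set q : End K V := b.constr K
    (Fin.lastCases (motive := fun _ ↦ V) 0 (fun i : Fin m ↦ b i.succ)) with hq
  have q_last : q (b (Fin.last m)) = 0 := by simp [hq]
  have q_cast (i : Fin m) : q (b i.castSucc) = b i.succ := by simp [hq]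
  have e_cast (i : Fin m) : (a - q) (b i.castSucc) = d i • b i.castSucc := by
    simp [q_cast, ha]
  have e_last : (a - q) (b (Fin.last m)) = a (b (Fin.last m)) := by simp [q_last]
  have hnil (j : ℕ) : ∀ i : Fin (m + 1), m < i + j → (q ^ j) (b i) = 0 := by
    induction j with
    | zero => intro i hi; omega
    | succ j ih =>
      intro i hi
      rw [pow_succ, Module.End.mul_apply]
      induction i using Fin.lastCases with
      | last => rw [q_last, map_zero]
      | cast i =>
        rw [q_cast]
        apply ih
        simp at hi ⊢
        omega
  refine ⟨a - q, q, ?_, ⟨m + 1, b.ext fun i ↦ ?_⟩, by simp⟩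
  · refine b.ext fun i ↦ ?_
    rw [Module.End.mul_apply]
    induction i using Fin.lastCases with
    | last =>
      rw [e_last]
      conv_lhs => rw [← b.sum_repr (a (b (Fin.last m)))]
      rw [map_sum, Fin.sum_univ_castSucc]
      simp only [map_smul, e_cast, e_last, smul_smul, hc, hlast]
      simp
    | cast i => rw [e_cast, map_smul, e_cast, smul_smul, hd]
  · simpa using hnil (m + 1) i (by omega)

theorem IsNilCleanElem.of_prod {K W C : Type*} [Field K] [AddCommGroup W] [Module K W]
    [AddCommGroup C] [Module K C] (a : End K (W × C)) (ha : ∀ w, (a (w, 0)).2 = 0)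
    (hW : ∀ f : End K W, IsNilCleanElem f) (hC : ∀ f : End K C, IsNilCleanElem f) :
    IsNilCleanElem a := by
  obtain ⟨e₁, q₁, he₁, ⟨n₁, hq₁⟩, h₁⟩ := hW (LinearMap.fst K W C ∘ₗ a ∘ₗ LinearMap.inl K W C)
  obtain ⟨e₂, q₂, he₂, ⟨n₂, hq₂⟩, h₂⟩ := hC (LinearMap.snd K W C ∘ₗ a ∘ₗ LinearMap.inr K W C)
  set q : End K (W × C) := a - e₁.prodMap e₂ with hq
  have q_left (w : W) : q (w, 0) = (q₁ w, 0) := by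
    have := LinearMap.congr_fun h₁ w
    simp at this
    ext <;> simp [hq, ha, this]
  have q_right (x : W × C) : (q x).2 = q₂ x.2 := by
    have := LinearMap.congr_fun h₂ x.2
    simp at this
    have hx : a x = a (x.1, 0) + a (0, x.2) := by rw [← map_add]; simp
    simp [hq, hx, ha, this]
  have pow_left (n : ℕ) (w : W) : (q ^ n) (w, 0) = ((q₁ ^ n) w, 0) := by
    induction n with
    | zero => simp
    | succ n ih => rw [pow_succ', Module.End.mul_apply, ih, q_left, pow_succ', Module.End.mul_apply]
  have pow_right (n : ℕ) (x : W × C) : ((q ^ n) x).2 = (q₂ ^ n) x.2 := by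
    induction n with
    | zero => simp
    | succ n ih => rw [pow_succ', Module.End.mul_apply, q_right, ih, pow_succ', Module.End.mul_apply]
  refine ⟨e₁.prodMap e₂, q, ?_, ⟨n₁ + n₂, LinearMap.ext fun x ↦ ?_⟩, by simp [hq]⟩
  · refine LinearMap.ext fun x ↦ ?_
    have h1 := LinearMap.congr_fun he₁ x.1
    have h2 := LinearMap.congr_fun he₂ x.2
    simp at h1 h2
    ext <;> simp [h1, h2]
  · have : (q ^ n₂) x = (((q ^ n₂) x).1, 0) := by
      ext <;> simp [pow_right, hq₂]
    rw [pow_add, Module.End.mul_apply, this, pow_left, hq₁]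
    simp

theorem aeval_eq_zero_of_apply_eq_zero {K V : Type*} [Field K] [AddCommGroup V] [Module K V]
    {a : End K V}
    (hs : ∀ W : Submodule K V, W ≤ W.comap a → W = ⊥ ∨ W = ⊤) {v : V} (hv : v ≠ 0)
    {g : K[X]} (hg : aeval a g v = 0) : aeval a g = 0 := by
  rcases hs (LinearMap.ker (aeval a g)) (fun w hw ↦ by
    simp only [Submodule.mem_comap, LinearMap.mem_ker] at hw ⊢
    have : aeval a g * a = a * aeval a g := by
      have := congrArg (aeval a) (mul_comm g X)
      simpa using this
    rw [← Module.End.mul_apply, this, Module.End.mul_apply, hw, map_zero]) with h | h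
  · have : v ∈ LinearMap.ker (aeval a g) := hg
    rw [h] at this
    exact absurd this hv
  · exact LinearMap.ker_eq_top.mp h

theorem natDegree_minpoly_eq_finrank {K V : Type*} [Field K] [AddCommGroup V] [Module K V]
    [FiniteDimensional K V] {a : End K V}
    (hs : ∀ W : Submodule K V, W ≤ W.comap a → W = ⊥ ∨ W = ⊤) {v : V} (hv : v ≠ 0) :
    (minpoly K a).natDegree = finrank K V := by
  have hmon : (minpoly K a).Monic := minpoly.monic (Algebra.IsIntegral.isIntegral a)
  apply le_antisymm
  · have := natDegree_le_of_dvd (LinearMap.minpoly_dvd_charpoly a) a.charpoly_monic.ne_zero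
    rwa [a.charpoly_natDegree] at this
  · let ev : K[X] →ₗ[K] V := (LinearMap.applyₗ v) ∘ₗ (aeval a).toLinearMap
    have hev (g : K[X]) : ev g = aeval a g v := rfl
    have htop : LinearMap.range ev = ⊤ := by
      refine (hs _ ?_).resolve_left fun h ↦ hv ?_
      · rintro _ ⟨g, rfl⟩
        exact ⟨X * g, by simp [hev]⟩
      · have : v ∈ LinearMap.range ev := ⟨1, by simp [hev]⟩
        rwa [h] at this
    have hsurj : Function.Surjective (ev ∘ₗ (degreeLT K (minpoly K a).natDegree).subtype) := by
      intro w
      obtain ⟨g, rfl⟩ := LinearMap.range_eq_top.mp htop w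
      refine ⟨⟨g %ₘ minpoly K a, mem_degreeLT.mpr ?_⟩, ?_⟩
      · rw [← degree_eq_natDegree hmon.ne_zero]
        exact degree_modByMonic_lt _ hmon
      · conv_rhs => rw [← modByMonic_add_div g (minpoly K a)]
        simp [hev]
    have := LinearMap.finrank_le_finrank_of_surjective hsurj
    rwa [(degreeLTEquiv K _).finrank_eq, finrank_fin_fun] at this

theorem linearIndependent_aeval_sequence {K V : Type*} [Field K] [AddCommGroup V] [Module K V]
    [FiniteDimensional K V] {a : End K V}
    (hs : ∀ W : Submodule K V, W ≤ W.comap a → W = ⊥ ∨ W = ⊤) {v : V} (hv : v ≠ 0)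
    (P : Polynomial.Sequence K) {k : ℕ} (hk : finrank K V = k) :
    LinearIndependent K (fun i : Fin k ↦ aeval a (P i) v) := by
  subst hk
  rw [Fintype.linearIndependent_iff]
  intro c hc
  have h0 : aeval a (∑ i : Fin (finrank K V), c i • P i) v = 0 := by
    rw [map_sum, LinearMap.sum_apply, ← hc]
    simp
  have h1 := minpoly.dvd K a (aeval_eq_zero_of_apply_eq_zero hs hv h0)
  have h2 : ∑ i : Fin (finrank K V), c i • P i = 0 := by
    refine eq_zero_of_dvd_of_degree_lt h1 ?_
    rw [degree_eq_natDegree (minpoly.ne_zero (Algebra.IsIntegral.isIntegral a)),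
      natDegree_minpoly_eq_finrank hs hv]
    refine (degree_sum_le _ _).trans_lt ?_
    rw [Finset.sup_lt_iff (by exact WithBot.bot_lt_coe _)]
    intro i _
    refine (degree_smul_le _ _).trans_lt ?_
    rw [P.degree_eq]
    exact_mod_cast i.2
  exact Fintype.linearIndependent_iff.mp
    (P.linearIndependent.comp (fun i : Fin (finrank K V) ↦ (i : ℕ)) Fin.val_injective) c h2

theorem minpoly_eq_of_basis_aeval {K V : Type*} [Field K] [AddCommGroup V] [Module K V]
    [FiniteDimensional K V] {a : End K V}
    (hs : ∀ W : Submodule K V, W ≤ W.comap a → W = ⊥ ∨ W = ⊤) {v : V} (hv : v ≠ 0)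
    (P : Polynomial.Sequence K) (hP : ∀ i, (P i).Monic) {m : ℕ} (b : Basis (Fin (m + 1)) K V)
    (hb : ∀ i, b i = aeval a (P i) v) :
    minpoly K a = X * P m - ∑ i, C (b.repr (a (b (Fin.last m))) i) * P i := by
  have hk : finrank K V = m + 1 := by simpa using finrank_eq_card_basis b
  set r := ∑ i, C (b.repr (a (b (Fin.last m))) i) * P i with hr
  have hdeg : (X * P m).natDegree = m + 1 := by
    rw [natDegree_X_mul (P.ne_zero m), P.natDegree_eq]
  have hlt : r.degree < (X * P m).degree := by
    rw [degree_eq_natDegree (mul_ne_zero X_ne_zero (P.ne_zero m)), hdeg]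
    refine (degree_sum_le _ _).trans_lt ?_
    rw [Finset.sup_lt_iff (by exact WithBot.bot_lt_coe _)]
    intro i _
    rw [← smul_eq_C_mul]
    refine (degree_smul_le _ _).trans_lt ?_
    rw [P.degree_eq]
    exact_mod_cast i.2
  have hzero : aeval a (X * P m - r) v = 0 := by
    have h1 : aeval a r v = a (b (Fin.last m)) := by
      conv_rhs => rw [← b.sum_repr (a (b (Fin.last m)))]
      simp [hr, hb, Module.algebraMap_end_apply]
    rw [map_sub, LinearMap.sub_apply, h1, hb]
    simp
  have hmon : (X * P m - r).Monic := (monic_X.mul (hP m)).sub_of_left hlt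
  refine (eq_of_monic_of_dvd_of_natDegree_le (minpoly.monic (Algebra.IsIntegral.isIntegral a)) hmon
    (minpoly.dvd K a (aeval_eq_zero_of_apply_eq_zero hs hv hzero)) ?_).symm
  rw [natDegree_minpoly_eq_finrank hs hv, natDegree_eq_of_degree_eq (degree_sub_eq_left_of_degree_lt hlt),
    hdeg, hk]

/-- The polynomial sequence `Xⁱ`. -/
noncomputable def powXSequence (K : Type*) [Field K] : Polynomial.Sequence K where
  elems' i := X ^ i
  degree_eq' i := by simp

/-- The polynomial sequence `1, X, X (X - 1), X² (X - 1), X³ (X - 1), …`. -/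
noncomputable def powXMulSubOneSequence (K : Type*) [Field K] : Polynomial.Sequence K where
  elems' i := match i with
    | 0 => 1
    | 1 => X
    | i + 2 => X ^ (i + 1) * (X - C 1)
  degree_eq' i := match i with
    | 0 => by simp
    | 1 => by simp
    | i + 2 => by
      rw [degree_mul, degree_X_pow, degree_X_sub_C]
      norm_cast

theorem exists_basis_aeval_sequence {K V : Type*} [Field K] [AddCommGroup V] [Module K V]
    [FiniteDimensional K V] {a : End K V}
    (hs : ∀ W : Submodule K V, W ≤ W.comap a → W = ⊥ ∨ W = ⊤) {v : V} (hv : v ≠ 0)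
    (P : Polynomial.Sequence K) {k : ℕ} (hk : finrank K V = k) [NeZero k] :
    ∃ b : Basis (Fin k) K V, ∀ i, b i = aeval a (P i) v :=
  ⟨basisOfLinearIndependentOfCardEqFinrank (linearIndependent_aeval_sequence hs hv P hk)
    (by simp [hk]), fun i ↦ by simp⟩

theorem isNilCleanElem_of_forall_invariant {V : Type*} [AddCommGroup V] [Module (ZMod 2) V]
    [FiniteDimensional (ZMod 2) V] (a : End (ZMod 2) V)
    (hs : ∀ W : Submodule (ZMod 2) V, W ≤ W.comap a → W = ⊥ ∨ W = ⊤) : IsNilCleanElem a := by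
  by_cases ha0 : a = 0
  · exact ⟨0, 0, .zero, .zero, by simp [ha0]⟩
  by_cases ha1 : a = 1
  · exact ⟨1, 0, .one, .zero, by simp [ha1]⟩
  obtain ⟨v, hv⟩ : ∃ v : V, v ≠ 0 := by
    by_contra! h
    exact ha0 (LinearMap.ext fun v ↦ by simp [h v])
  set p := minpoly (ZMod 2) a with hp
  have hmon : p.Monic := minpoly.monic (Algebra.IsIntegral.isIntegral a)
  have hroot (x : ZMod 2) (hx : a ≠ algebraMap _ _ x) : p.eval x = 1 := by
    refine Fin.eq_one_of_ne_zero _ fun h ↦ hx ?_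
    obtain ⟨w, hw⟩ := (Module.End.hasEigenvalue_of_isRoot (f := a) h).exists_hasEigenvector
    have : aeval a (X - C x) = 0 :=
      aeval_eq_zero_of_apply_eq_zero hs hw.2 (by simp [hw.apply_eq_smul, Module.algebraMap_end_apply])
    simpa [sub_eq_zero] using this
  have h0 : p.eval 0 = 1 := hroot 0 (by simpa using ha0)
  have h1 : p.eval 1 = 1 := hroot 1 (by simpa using ha1)
  obtain ⟨m, hm⟩ : ∃ m, finrank (ZMod 2) V = m + 1 :=
    have : Nontrivial V := ⟨v, 0, hv⟩
    ⟨_, (Nat.succ_pred_eq_of_pos finrank_pos).symm⟩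
  have hdeg : p.natDegree = m + 1 := (natDegree_minpoly_eq_finrank hs hv).trans hm
  have hlead : p.coeff (m + 1) = 1 := by rw [← hdeg]; exact hmon
  have hcoeff (P : Polynomial.Sequence (ZMod 2)) (hP : ∀ i, (P i).Monic) (c : Fin (m + 1) → ZMod 2)
      (hc : p = X * P m - ∑ i, C (c i) * P i) :
      p.coeff m = (X * P m).coeff m - c (Fin.last m) := by
    rw [hc, coeff_sub, finsetSum_coeff, Fin.sum_univ_castSucc, Finset.sum_eq_zero]
    · have := (hP m).coeff_natDegree
      rw [P.natDegree_eq] at this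
      simp [this]
    · intro i _
      rw [coeff_C_mul, coeff_eq_zero_of_natDegree_lt (by simp), mul_zero]
  by_cases ht : p.coeff m = 1
  · obtain ⟨b, hb⟩ := exists_basis_aeval_sequence hs hv (powXSequence (ZMod 2)) hm
    have hmonic (i : ℕ) : (powXSequence (ZMod 2) i).Monic := monic_X_pow i
    have hc := hcoeff _ hmonic _ (minpoly_eq_of_basis_aeval hs hv _ hmonic b hb)
    refine isNilCleanElem_of_basis_hessenberg b a 0 (by simp) (fun i ↦ ?_) ?_ (by simp)
    · simp only [hb]
      simp [powXSequence, pow_succ']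
    · have hx : (X * powXSequence (ZMod 2) m).coeff m = 0 := by
        change (X * X ^ m : (ZMod 2)[X]).coeff m = 0
        rw [← pow_succ', coeff_X_pow]; simp
      rw [hx, ht] at hc
      generalize b.repr (a (b (Fin.last m))) (Fin.last m) = c at hc
      revert c; decide
  · replace ht : p.coeff m = 0 := by
      generalize p.coeff m = c at ht
      revert c; decide
    match m with
    | 0 =>
      rw [← coeff_zero_eq_eval_zero, ht] at h0
      exact absurd h0 (by decide)
    | 1 =>
      rw [← coeff_zero_eq_eval_zero] at h0
      rw [eval_eq_sum_range, hdeg] at h1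
      simp [Finset.sum_range_succ, h0, ht, hlead] at h1
    | m + 2 =>
      obtain ⟨b, hb⟩ := exists_basis_aeval_sequence hs hv (powXMulSubOneSequence (ZMod 2)) hm
      have hmonic (i : ℕ) : (powXMulSubOneSequence (ZMod 2) i).Monic := match i with
        | 0 => monic_one
        | 1 => monic_X
        | i + 2 => (monic_X_pow (i + 1)).mul (monic_X_sub_C 1)
      have P0 : powXMulSubOneSequence (ZMod 2) 0 = 1 := rfl
      have P1 : powXMulSubOneSequence (ZMod 2) 1 = X := rfl
      have P2 (i : ℕ) : powXMulSubOneSequence (ZMod 2) (i + 2) = X ^ (i + 1) * (X - C 1) := rfl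
      have hmp := minpoly_eq_of_basis_aeval hs hv _ hmonic b hb
      have hc := hcoeff _ hmonic _ hmp
      rw [← hp] at hmp
      set c := b.repr (a (b (Fin.last (m + 2)))) with hcdef
      have e0 := congrArg (eval 0) hmp
      have e1 := congrArg (eval 1) hmp
      rw [h0, Fin.sum_univ_succ, Fin.sum_univ_succ] at e0
      rw [h1, Fin.sum_univ_succ, Fin.sum_univ_succ] at e1
      simp [P0, P1, P2, eval_finsetSum] at e0 e1
      refine isNilCleanElem_of_basis_hessenberg b a (fun i ↦ if i = 1 then 1 else 0)
        (by simp) (fun i ↦ ?_) ?_ (fun i ↦ ?_)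
      · simp only [hb]
        match i with
        | ⟨0, _⟩ => simp [P0, P1]
        | ⟨1, _⟩ =>
          have h := congrArg (fun f ↦ aeval a f v) (P2 0)
          simp at h
          have h2 : 2 % (m + 2 + 1) = 2 := Nat.mod_eq_of_lt (by omega)
          simp [P1, h, h2]
        | ⟨i + 2, h⟩ =>
          have hi : (⟨i + 2, h⟩ : Fin (m + 2)) ≠ 1 := by simp [Fin.ext_iff]
          simp only [Fin.val_castSucc, Fin.val_succ, P2, hi]
          simp [pow_succ' _ (i + 1)]
      · have hx : (X * powXMulSubOneSequence (ZMod 2) (m + 2)).coeff (m + 2) = -1 := by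
          rw [P2, mul_sub, ← pow_succ, mul_sub, ← pow_succ', coeff_sub, coeff_X_pow,
            ← mul_assoc, ← pow_succ', coeff_mul_C, coeff_X_pow]
          simp
        rw [hx, ht] at hc
        rw [← hcdef]
        generalize c (Fin.last (m + 2)) = x at hc
        revert x; decide
      · by_cases hi : i = 1
        · have h1 : (1 : Fin (m + 2)).castSucc = 1 := rfl
          rw [hi, h1, ← hcdef]
          rw [← e0] at e1
          simpa using e1
        · simp [hi]

theorem IsNilCleanElem.map {R S : Type*} [Ring R] [Ring S] {a : R} (h : IsNilCleanElem a)
    (f : R →+* S) : IsNilCleanElem (f a) := by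
  obtain ⟨e, q, he, hq, rfl⟩ := h
  exact ⟨f e, f q, he.map f, hq.map f, map_add f q e⟩

theorem isNilCleanElem_end_zmod_two {V : Type*} [AddCommGroup V] [Module (ZMod 2) V]
    [FiniteDimensional (ZMod 2) V] (a : End (ZMod 2) V) : IsNilCleanElem a := by
  induction hn : finrank (ZMod 2) V using Nat.strong_induction_on generalizing V with
  | _ n ih =>
  by_cases hs : ∀ W : Submodule (ZMod 2) V, W ≤ W.comap a → W = ⊥ ∨ W = ⊤
  · exact isNilCleanElem_of_forall_invariant a hs
  push Not at hs
  obtain ⟨W, haW, hbot, htop⟩ := hs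
  obtain ⟨C, hC⟩ := W.exists_isCompl
  have hsum := Submodule.finrank_add_eq_of_isCompl hC
  have hW : finrank (ZMod 2) W < n := hn ▸ Submodule.finrank_lt htop
  have hWpos : 0 < finrank (ZMod 2) W := by
    rwa [Nat.pos_iff_ne_zero, ne_eq, Submodule.finrank_eq_zero]
  let ε := W.prodEquivOfIsCompl C hC
  have h : IsNilCleanElem (ε.symm.conjRingEquiv a) := by
    refine .of_prod _ (fun w ↦ ?_) (fun f ↦ ih _ hW f rfl) (fun f ↦ ih _ (by omega) f rfl)
    have : a (ε (w, 0)) ∈ W := by simpa [ε] using haW w.2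
    simpa [ε] using this
  simpa using h.map (ε.symm.conjRingEquiv.symm : _ →+* End (ZMod 2) V)

theorem isNilCleanElem_matrix_zmod_two {ι : Type*} [Fintype ι] [DecidableEq ι]
    (a : Matrix ι ι (ZMod 2)) : IsNilCleanElem a := by
  let ε : Matrix ι ι (ZMod 2) ≃+* End (ZMod 2) (ι → ZMod 2) := Matrix.toLinAlgEquiv'.toRingEquiv
  simpa using (isNilCleanElem_end_zmod_two (ε a)).map (ε.symm : _ →+* Matrix ι ι (ZMod 2))

theorem IsNilpotent.eq_zero_of_apply_eq_smul {D V : Type*} [DivisionRing D] [AddCommGroup V]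
    [Module D V] {Q : End D V} (hQ : IsNilpotent Q) {t : D} (ht : t ≠ 0) {y : V}
    (hy : Q y = t • y) : y = 0 := by
  obtain ⟨n, hn⟩ := hQ
  have (j : ℕ) : (Q ^ j) y = t ^ j • y := by
    induction j with
    | zero => simp
    | succ j ih =>
      rw [_root_.pow_succ, Module.End.mul_apply, hy, map_smul, ih, smul_smul, ← pow_succ']
  have h0 := this n
  rw [hn] at h0
  exact (smul_eq_zero.mp h0.symm).resolve_left (pow_ne_zero n ht)

theorem eq_one_of_rank_one_nilClean {D V : Type*} [DivisionRing D] [AddCommGroup V] [Module D V]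
    (l : V →ₗ[D] D) {b : V} (hb : l b = 1) {x : D} (hx : x ≠ 0) {E Q : End D V}
    (hE : IsIdempotentElem E) (hQ : IsNilpotent Q)
    (h : ∀ v, (l v * x) • b = Q v + E v) : x = 1 := by
  obtain ⟨n, hn⟩ := id hQ
  have hQn (y : V) : (Q ^ n) y = 0 := by simp [hn]
  have hE' (y : V) : E (E y) = E y := LinearMap.congr_fun hE y
  have hker (y : V) (hy : E y = y) (hl : l y = 0) : y = 0 := by
    refine hQ.eq_zero_of_apply_eq_smul (t := -1) (by simp) ?_
    have := h y
    rw [hl, hy, zero_mul, zero_smul] at this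
    rw [neg_one_smul]
    exact eq_neg_of_add_eq_zero_left this.symm
  obtain ⟨u, hu, hlu⟩ : ∃ u, E u = u ∧ l u = 1 := by
    have : ∃ y, E y ≠ 0 := by
      by_contra! hz
      have hb0 := hQ.eq_zero_of_apply_eq_smul hx (by have := h b; rw [hz, hb, one_mul, add_zero] at this; exact this.symm)
      simp [hb0] at hb
    obtain ⟨y, hy⟩ := this
    have hl : l (E y) ≠ 0 := fun h0 ↦ hy (hker _ (hE' y) h0)
    exact ⟨(l (E y))⁻¹ • E y, by simp [hE'], by simp [hl]⟩
  have hEv (y : V) : E y = l (E y) • u :=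
    sub_eq_zero.mp (hker _ (by simp [hE', hu]) (by simp [hlu]))
  by_contra hx1
  set p := l (E b)
  have hQu : Q u = x • b - u := by
    have := h u
    rw [hlu, one_mul, hu] at this
    rw [this, add_sub_cancel_right]
  have hQb : Q b = x • b - p • u := by
    have := h b
    rw [hb, one_mul, hEv b] at this
    rw [this, add_sub_cancel_right]
  have hQQ : Q (Q u) = (x - 1) • Q u + (x - x * p) • u := by
    conv_lhs => rw [hQu, map_sub, map_smul, hQb, hQu]
    rw [hQu]
    simp only [smul_sub, sub_smul, smul_smul, one_smul, sub_mul, one_mul]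
    abel
  have hw : Q u ≠ 0 := by
    intro h0
    have := congrArg l (hQu.symm.trans h0)
    simp [hb, hlu] at this
    exact hx1 (sub_eq_zero.mp this)
  by_cases hα : x - x * p = 0
  · rw [hα, zero_smul, add_zero] at hQQ
    exact hw (hQ.eq_zero_of_apply_eq_smul (sub_ne_zero.mpr hx1) hQQ)
  · have hmem (j : ℕ) : u ∈ LinearMap.range (Q ^ j) := by
      induction j with
      | zero => simp
      | succ j ih =>
        obtain ⟨y, hy⟩ := ih
        refine ⟨(x - x * p)⁻¹ • (Q y - (x - 1) • y), ?_⟩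
        have hcomm : (Q ^ j) (Q y) = Q ((Q ^ j) y) := by
          rw [← Module.End.mul_apply, ← pow_succ, pow_succ', Module.End.mul_apply]
        rw [pow_succ', Module.End.mul_apply, map_smul, map_sub, map_smul, hcomm, hy, map_smul,
          map_sub, map_smul, hy, hQQ, add_sub_cancel_left, smul_smul, inv_mul_cancel₀ hα, one_smul]
    obtain ⟨y, hy⟩ := hmem n
    rw [hQn] at hy
    simp [← hy] at hlu

theorem eq_one_of_isNilCleanElem_single {D ι : Type*} [DivisionRing D] [Fintype ι] [DecidableEq ι]
    (i : ι) {x : D} (hx : x ≠ 0) (h : IsNilCleanElem (Matrix.single i i x)) : x = 1 := by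
  obtain ⟨e, q, he, ⟨n, hq⟩, h⟩ := h
  have hpow (j : ℕ) : q.toLinearMapRight' ^ j = (q ^ j).toLinearMapRight' := by
    induction j with
    | zero => simp [Module.End.one_eq_id]
    | succ j ih => rw [pow_succ, pow_succ', Matrix.toLinearMapRight'_mul, ih]; rfl
  refine eq_one_of_rank_one_nilClean (LinearMap.proj i) (b := Pi.single i 1) (by simp) hx
    (E := e.toLinearMapRight') (Q := q.toLinearMapRight') ?_ ⟨n, ?_⟩ fun v ↦ ?_
  · have := congrArg Matrix.toLinearMapRight' he
    rw [Matrix.toLinearMapRight'_mul] at this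
    exact this
  · rw [hpow, hq, map_zero]
  · rw [← LinearMap.add_apply, ← map_add, ← h]
    ext j
    by_cases hj : j = i
    · simp [Matrix.vecMul, dotProduct, Matrix.single_apply, hj]
    · simp [Matrix.vecMul, dotProduct, hj, Ne.symm hj]

theorem IsWeaklyNilCleanElem.isNilCleanElem_or_neg {R : Type*} [Ring R] {a : R}
    (h : IsWeaklyNilCleanElem a) : IsNilCleanElem a ∨ IsNilCleanElem (-a) := by
  obtain ⟨e, q, he, hq, rfl | rfl⟩ := h
  · exact .inl ⟨e, q, he, hq, rfl⟩
  · exact .inr ⟨e, -q, he, hq.neg, by abel⟩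

theorem IsNilCleanElem.isWeaklyNilCleanElem {R : Type*} [Ring R] {a : R}
    (h : IsNilCleanElem a) : IsWeaklyNilCleanElem a := by
  obtain ⟨e, q, he, hq, h⟩ := h
  exact ⟨e, q, he, hq, .inl h⟩

theorem IsNilCleanElem.isWeaklyNilCleanElem_of_neg {R : Type*} [Ring R] {a : R}
    (h : IsNilCleanElem (-a)) : IsWeaklyNilCleanElem a := by
  obtain ⟨e, q, he, hq, h⟩ := h
  exact ⟨e, -q, he, hq.neg, .inr (by rw [← neg_neg a, h]; abel)⟩

theorem IsWeaklyNilCleanElem.map {R S : Type*} [Ring R] [Ring S] {a : R}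
    (h : IsWeaklyNilCleanElem a) (f : R →+* S) : IsWeaklyNilCleanElem (f a) := by
  obtain h | h := h.isNilCleanElem_or_neg
  · exact (h.map f).isWeaklyNilCleanElem
  · exact IsNilCleanElem.isWeaklyNilCleanElem_of_neg (map_neg f a ▸ h.map f)

theorem eq_zero_or_one_or_neg_one_of_single {D ι : Type*} [DivisionRing D] [Fintype ι]
    [DecidableEq ι] (i : ι) (h : ∀ x : D, IsWeaklyNilCleanElem (Matrix.single i i x)) (x : D) :
    x = 0 ∨ x = 1 ∨ x = -1 := by
  by_cases hx : x = 0
  · exact .inl hx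
  obtain h | h := (h x).isNilCleanElem_or_neg
  · exact .inr (.inl (eq_one_of_isNilCleanElem_single i hx h))
  · have : -Matrix.single i i x = Matrix.single i i (-x) := (map_neg (Matrix.singleAddMonoidHom i i) x).symm
    rw [this] at h
    exact .inr (.inr (neg_eq_iff_eq_neg.mp
      (eq_one_of_isNilCleanElem_single i (neg_ne_zero.mpr hx) h)))

theorem nonempty_ringEquiv_zmod_two_or_three {D : Type*} [DivisionRing D]
    (h : ∀ x : D, x = 0 ∨ x = 1 ∨ x = -1) :
    Nonempty (D ≃+* ZMod 2) ∨ Nonempty (D ≃+* ZMod 3) := by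
  classical
  let _ : Fintype D := ⟨{0, 1, -1}, fun x ↦ by simpa using h x⟩
  have hcard : Fintype.card D = ({0, 1, -1} : Finset D).card := rfl
  by_cases h2 : (1 : D) = -1
  · left
    refine ⟨(ZMod.ringEquivOfPrime D Nat.prime_two ?_).symm⟩
    rw [hcard, ← h2]
    simp
  · right
    refine ⟨(ZMod.ringEquivOfPrime D Nat.prime_three ?_).symm⟩
    rw [hcard, Finset.card_eq_three]
    exact ⟨0, 1, -1, by simp, by simp, h2, rfl⟩

theorem not_isNilCleanElem_single_sub_single {ι : Type*} [Fintype ι] [DecidableEq ι] {i j : ι}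
    (hij : i ≠ j) :
    ¬IsNilCleanElem (Matrix.single i i 1 - Matrix.single j j 1 : Matrix ι ι (ZMod 3)) := by
  intro h
  set a : Matrix ι ι (ZMod 3) := Matrix.single i i 1 - Matrix.single j j 1 with ha
  have htr : a.trace = 0 := by simp [ha]
  let ε : Matrix ι ι (ZMod 3) ≃+* End (ZMod 3) (ι → ZMod 3) := Matrix.toLinAlgEquiv'.toRingEquiv
  have hεa (v : ι → ZMod 3) : ε a v = Pi.single i (v i) - Pi.single j (v j) := by
    change a.mulVec v = _
    rw [ha, Matrix.sub_mulVec, Matrix.single_mulVec, Matrix.single_mulVec]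
    simp [Pi.single]
  have htr' : LinearMap.trace _ _ (ε a) = 0 := (Matrix.trace_toLin'_eq a).trans htr
  obtain ⟨E, Q, hE, hQ, h⟩ := h.map (ε : _ →+* End (ZMod 3) (ι → ZMod 3))
  change ε a = Q + E at h
  rw [h, map_add, (LinearMap.isNilpotent_trace_of_isNilpotent hQ).eq_zero, zero_add,
    (LinearMap.IsIdempotentElem.isProj_range E hE).trace] at htr'
  let ρ : (ι → ZMod 3) →ₗ[ZMod 3] (ZMod 3 × ZMod 3) := (LinearMap.proj i).prod (LinearMap.proj j)
  have hinj : Function.Injective (ρ ∘ₗ (LinearMap.range E).subtype) := by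
    rw [injective_iff_map_eq_zero]
    rintro ⟨w, y, rfl⟩ hw
    simp [ρ] at hw
    have hEy : E (E y) = E y := LinearMap.congr_fun hE y
    have := LinearMap.congr_fun h (E y)
    rw [hεa, hw.1, hw.2, LinearMap.add_apply, hEy] at this
    simp at this
    exact Subtype.ext (hQ.eq_zero_of_apply_eq_smul (t := -1) (by decide) (by
      rw [neg_one_smul]; exact eq_neg_of_add_eq_zero_left this.symm))
  have hle := LinearMap.finrank_le_finrank_of_injective hinj
  rw [finrank_prod, finrank_self] at hle
  rw [ZMod.natCast_eq_zero_iff] at htr'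
  have h0 : finrank (ZMod 3) (LinearMap.range E) = 0 := Nat.eq_zero_of_dvd_of_lt htr' (by omega)
  rw [Submodule.finrank_eq_zero, LinearMap.range_eq_bot] at h0
  rw [h0, add_zero] at h
  have := hQ.eq_zero_of_apply_eq_smul (t := 1) (y := Pi.single i 1) (by decide) (by rw [← h, hεa]; simp [hij.symm])
  simp at this

theorem not_isWeaklyNilCleanElem_single_sub_single {ι : Type*} [Fintype ι] [DecidableEq ι] {i j : ι}
    (hij : i ≠ j) :
    ¬IsWeaklyNilCleanElem (Matrix.single i i 1 - Matrix.single j j 1 : Matrix ι ι (ZMod 3)) := by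
  intro h
  obtain h | h := h.isNilCleanElem_or_neg
  · exact not_isNilCleanElem_single_sub_single hij h
  · rw [neg_sub] at h
    exact not_isNilCleanElem_single_sub_single hij.symm h

theorem IsNilCleanElem.pi {ι : Type*} [Finite ι] {A : ι → Type*} [∀ i, Ring (A i)] {a : ∀ i, A i}
    (h : ∀ i, IsNilCleanElem (a i)) : IsNilCleanElem a := by
  have := Fintype.ofFinite ι
  choose e q he hq h using h
  choose n hn using hq
  refine ⟨e, q, funext he, ⟨∑ i, n i, funext fun i ↦ ?_⟩, funext h⟩
  exact pow_eq_zero_of_le (Finset.single_le_sum (f := n) (by simp) (Finset.mem_univ i)) (hn i)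

theorem IsGWNCRing.of_surjective {R S : Type*} [Ring R] [Ring S] (h : IsGWNCRing R) (f : R →+* S)
    (hf : Function.Surjective f) : IsGWNCRing S := by
  intro s hs
  obtain ⟨r, rfl⟩ := hf s
  exact (h r fun hr ↦ hs (hr.map f)).map f

theorem IsNilCleanElem.of_ringEquiv {R S : Type*} [Ring R] [Ring S] (ε : R ≃+* S) {a : R}
    (h : IsNilCleanElem (ε a)) : IsNilCleanElem a := by
  simpa only [RingEquiv.toRingHom_eq_coe, RingHom.coe_coe, RingEquiv.symm_apply_apply]
    using h.map ε.symm.toRingHom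

theorem IsWeaklyNilCleanElem.of_ringEquiv {R S : Type*} [Ring R] [Ring S] (ε : R ≃+* S) {a : R}
    (h : IsWeaklyNilCleanElem (ε a)) : IsWeaklyNilCleanElem a := by
  simpa only [RingEquiv.toRingHom_eq_coe, RingHom.coe_coe, RingEquiv.symm_apply_apply]
    using h.map ε.symm.toRingHom

theorem IsGWNCRing.of_ringEquiv {R S : Type*} [Ring R] [Ring S] (h : IsGWNCRing R) (ε : R ≃+* S) :
    IsGWNCRing S :=
  h.of_surjective ε.toRingHom ε.surjective

theorem IsGWNCRing.isNilpotent_of_map_eq_zero {R S : Type*} [Ring R] [Ring S] (h : IsGWNCRing R)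
    (f : R →+* S) [IsLocalHom f] {x : R} (hx : f x = 0) : IsNilpotent x := by
  by_cases hu : IsUnit x
  · have h0 : IsUnit (f 0) := by
      have := hu.map f
      rwa [hx, ← map_zero f] at this
    have := isUnit_zero_iff.mp (isUnit_of_map_unit f 0 h0)
    have : Subsingleton R := subsingleton_of_zero_eq_one this
    rw [Subsingleton.elim x 0]
    exact .zero
  obtain ⟨e, q, he, hq, h⟩ := h x hu
  have hfe : IsNilpotent (f e) := by
    rcases h with h | h
    · have : f e = f (-q) := by
        rw [h, map_add] at hx
        rw [map_neg]
        exact eq_neg_of_add_eq_zero_right hx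
      rw [this]
      exact hq.neg.map f
    · have : f e = f q := by
        rw [h, map_sub, sub_eq_zero] at hx
        exact hx.symm
      rw [this]
      exact hq.map f
  have he1 : IsUnit (1 - e) := isUnit_of_map_unit f _ (by
    rw [map_sub, map_one]
    exact hfe.isUnit_one_sub)
  have he0 : e = 0 := by
    have : (1 - e) * e = 0 := by rw [sub_mul, one_mul, he.eq, sub_self]
    exact (he1.mul_right_eq_zero).mp this
  rcases h with h | h <;> simpa [h, he0] using hq

theorem IsWeaklyNilCleanElem.of_map {R S : Type*} [Ring R] [Ring S] (f : R →+* S)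
    (hf : Function.Surjective f) (hker : ∀ x, f x = 0 → IsNilpotent x) {a : R}
    (h : IsWeaklyNilCleanElem (f a)) : IsWeaklyNilCleanElem a := by
  have lift (b : R) (h : IsNilCleanElem (f b)) : IsNilCleanElem b := by
    obtain ⟨e, q, he, ⟨n, hq⟩, h⟩ := h
    obtain ⟨e', he', rfl⟩ :=
      exists_isIdempotentElem_eq_of_ker_isNilpotent f hker e (hf e) he
    refine ⟨e', b - e', he', ?_, by simp⟩
    have : IsNilpotent ((b - e') ^ n) := hker _ (by rw [map_pow, map_sub, h, add_sub_cancel_right, hq])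
    exact this.of_pow
  obtain h | h := h.isNilCleanElem_or_neg
  · exact (lift a h).isWeaklyNilCleanElem
  · exact (lift (-a) (by rwa [map_neg])).isWeaklyNilCleanElem_of_neg

theorem not_isWeaklyNilCleanElem_one_neg_one :
    ¬IsWeaklyNilCleanElem ((1, -1) : ZMod 3 × ZMod 3) := by
  rintro ⟨e, q, he, hq, h⟩
  rw [hq.eq_zero, zero_add, zero_sub] at h
  revert e
  unfold IsIdempotentElem
  decide

theorem isGWNCRing_zmod_three_prod : IsGWNCRing (ZMod 3 × ZMod 3) := by
  intro a ha
  have h : IsIdempotentElem a ∨ IsIdempotentElem (-a) := by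
    have : ¬∃ b, a * b = 1 := fun ⟨b, hb⟩ ↦ ha (IsUnit.of_mul_eq_one b hb)
    revert a
    unfold IsIdempotentElem
    decide
  rcases h with h | h
  · exact ⟨a, 0, h, .zero, .inl (by simp)⟩
  · exact ⟨-a, 0, h, .zero, .inr (by simp)⟩

theorem isGWNCRing_matrix_zmod_three : IsGWNCRing (Matrix (Fin 2) (Fin 2) (ZMod 3)) := by
  intro a ha
  have hdet : a.det = 0 := by
    rw [Matrix.isUnit_iff_isUnit_det, isUnit_iff_ne_zero, not_not] at ha
    exact ha
  have hsq : a * a = a.trace • a := by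
    rw [Matrix.det_fin_two] at hdet
    ext i j
    fin_cases i <;> fin_cases j <;>
      simp [Matrix.mul_apply, Matrix.trace] <;> first | ring1 | linear_combination -hdet
  have htr : a.trace = 0 ∨ a.trace = 1 ∨ a.trace = -1 := by
    generalize a.trace = t
    revert t; decide
  rcases htr with h | h | h
  · exact ⟨0, a, .zero, ⟨2, by rw [pow_two, hsq, h, zero_smul]⟩, .inl (by simp)⟩
  · exact ⟨a, 0, by rw [IsIdempotentElem, hsq, h, one_smul], .zero, .inl (by simp)⟩
  · exact ⟨-a, 0, by rw [IsIdempotentElem, neg_mul_neg, hsq, h, neg_one_smul], .zero,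
      .inr (by simp)⟩

theorem Matrix.not_isUnit_of_row_eq_zero {D ι : Type*} [DivisionRing D] [Fintype ι] [DecidableEq ι]
    {a : Matrix ι ι D} (i : ι) (h : ∀ j, a i j = 0) : ¬IsUnit a := by
  intro hu
  obtain ⟨b, hb⟩ := hu.exists_right_inv
  have := congrFun (congrFun hb i) i
  simp [Matrix.mul_apply, h] at this

theorem isNilCleanElem_matrix_of_ringEquiv {D ι : Type*} [Ring D] [Fintype ι] [DecidableEq ι]
    (ε : D ≃+* ZMod 2) (a : Matrix ι ι D) : IsNilCleanElem a :=
  .of_ringEquiv ε.mapMatrix (isNilCleanElem_matrix_zmod_two _)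

theorem IsGWNCRing.matrix_divisionRing {D : Type*} [DivisionRing D] {d : ℕ} [NeZero d]
    (h : IsGWNCRing (Matrix (Fin d) (Fin d) D)) :
    (∀ a : Matrix (Fin d) (Fin d) D, IsUnit a ∨ a = 0) ∨
      Nonempty (Matrix (Fin d) (Fin d) D ≃+* Matrix (Fin 2) (Fin 2) (ZMod 3)) ∨
      IsWeaklyNilCleanRing (Matrix (Fin d) (Fin d) D) := by
  match d, ‹NeZero d› with
  | 1, _ =>
    left
    intro a
    by_cases ha : a = 0
    · exact .inr ha
    left
    let ε : Matrix (Fin 1) (Fin 1) D ≃+* D := Matrix.uniqueRingEquiv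
    refine isUnit_of_map_unit ε a (isUnit_iff_ne_zero.mpr ?_)
    rwa [ne_eq, map_eq_zero_iff _ ε.injective]
  | d + 2, _ =>
    right
    have hx := eq_zero_or_one_or_neg_one_of_single (D := D) (0 : Fin (d + 2)) fun x ↦
      h _ (Matrix.not_isUnit_of_row_eq_zero 1 (by simp))
    obtain ⟨⟨ε⟩⟩ | ⟨⟨ε⟩⟩ := nonempty_ringEquiv_zmod_two_or_three hx
    · exact .inr fun a ↦ (isNilCleanElem_matrix_of_ringEquiv ε a).isWeaklyNilCleanElem
    · left
      match d with
      | 0 => exact ⟨ε.mapMatrix⟩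
      | d + 1 =>
        have h' := h.of_ringEquiv (ε.mapMatrix (m := Fin (d + 3)))
        refine absurd (h' _ (Matrix.not_isUnit_of_row_eq_zero 2 fun j ↦ ?_))
          (not_isWeaklyNilCleanElem_single_sub_single (i := 0) (j := 1) (by simp))
        simp [Fin.ext_iff, Nat.mod_eq_of_lt]

theorem IsWeaklyNilCleanRing.matrix_divisionRing {D : Type*} [DivisionRing D] {d : ℕ} [NeZero d]
    (h : IsWeaklyNilCleanRing (Matrix (Fin d) (Fin d) D)) :
    (∀ a : Matrix (Fin d) (Fin d) D, IsNilCleanElem a) ∨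
      Nonempty (Matrix (Fin d) (Fin d) D ≃+* ZMod 3) := by
  have hx := eq_zero_or_one_or_neg_one_of_single (D := D) (0 : Fin d) fun x ↦ h _
  obtain ⟨⟨ε⟩⟩ | ⟨⟨ε⟩⟩ := nonempty_ringEquiv_zmod_two_or_three hx
  · exact .inl (isNilCleanElem_matrix_of_ringEquiv ε)
  · right
    match d, ‹NeZero d› with
    | 1, _ => exact ⟨Matrix.uniqueRingEquiv.trans ε⟩
    | d + 2, _ =>
      refine absurd ?_ (not_isWeaklyNilCleanElem_single_sub_single (ι := Fin (d + 2))
        (i := 0) (j := 1) (by simp))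
      have := (h (ε.mapMatrix.symm (Matrix.single 0 0 1 - Matrix.single 1 1 1))).map
        ε.mapMatrix.toRingHom
      simpa only [RingEquiv.toRingHom_eq_coe, RingHom.coe_coe, RingEquiv.apply_symm_apply] using this

theorem isWeaklyNilCleanRing_pi {ι : Type*} [Finite ι] {A : ι → Type*} [∀ i, Ring (A i)]
    (hA : ∀ i, IsWeaklyNilCleanRing (A i))
    (h : ∀ i j, i ≠ j → (∀ a : A i, IsNilCleanElem a) ∨ ∀ a : A j, IsNilCleanElem a) :
    IsWeaklyNilCleanRing (∀ i, A i) := by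
  intro a
  by_cases ha : ∀ i, IsNilCleanElem (a i)
  · exact (IsNilCleanElem.pi ha).isWeaklyNilCleanElem
  push Not at ha
  obtain ⟨i, hi⟩ := ha
  refine (IsNilCleanElem.pi fun j ↦ ?_).isWeaklyNilCleanElem_of_neg
  by_cases hij : i = j
  · subst hij
    exact ((hA i (a i)).isNilCleanElem_or_neg).resolve_left hi
  · exact (h i j hij).resolve_left (fun h ↦ hi (h _)) _

theorem IsGWNCRing.isWeaklyNilCleanRing_of_pi {ι : Type*} [DecidableEq ι] [Nontrivial ι]
    {A : ι → Type*} [∀ i, Ring (A i)] [∀ i, Nontrivial (A i)] (h : IsGWNCRing (∀ i, A i)) (i : ι) :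
    IsWeaklyNilCleanRing (A i) := by
  intro a
  obtain ⟨j, hj⟩ := exists_ne i
  have := (h (Pi.single i a) fun hu ↦ ?_).map (Pi.evalRingHom A i)
  · simpa using this
  · have := hu.map (Pi.evalRingHom A j)
    simp [hj] at this

theorem IsGWNCRing.eq_or_eq_of_pi {ι : Type*} [DecidableEq ι]
    {A : ι → Type*} [∀ i, Ring (A i)] [∀ i, Nontrivial (A i)] (h : IsGWNCRing (∀ i, A i)) {i j : ι}
    (hij : i ≠ j) (εi : A i ≃+* ZMod 3) (εj : A j ≃+* ZMod 3) (k : ι) : k = i ∨ k = j := by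
  by_contra! hk
  let f : (∀ i, A i) →+* ZMod 3 × ZMod 3 :=
    ((εi : A i →+* ZMod 3).comp (Pi.evalRingHom A i)).prod
      ((εj : A j →+* ZMod 3).comp (Pi.evalRingHom A j))
  refine not_isWeaklyNilCleanElem_one_neg_one ?_
  have := (h (Pi.single i 1 + Pi.single j (-1)) fun hu ↦ ?_).map f
  · simpa [f, hij, hij.symm] using this
  · have := hu.map (Pi.evalRingHom A k)
    simp [hk] at this

theorem IsGWNCRing.pi_matrix_divisionRing {n : ℕ} {D : Fin n → Type*} [∀ i, DivisionRing (D i)]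
    {d : Fin n → ℕ} [∀ i, NeZero (d i)]
    (h : IsGWNCRing (∀ i, Matrix (Fin (d i)) (Fin (d i)) (D i))) :
    (∀ a : ∀ i, Matrix (Fin (d i)) (Fin (d i)) (D i), IsUnit a ∨ a = 0) ∨
      Nonempty ((∀ i, Matrix (Fin (d i)) (Fin (d i)) (D i)) ≃+* Matrix (Fin 2) (Fin 2) (ZMod 3)) ∨
      Nonempty ((∀ i, Matrix (Fin (d i)) (Fin (d i)) (D i)) ≃+* ZMod 3 × ZMod 3) ∨
      IsWeaklyNilCleanRing (∀ i, Matrix (Fin (d i)) (Fin (d i)) (D i)) := by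
  obtain _ | _ | n := n
  · exact .inl fun a ↦ .inr (Subsingleton.elim _ _)
  · let _ : Unique (Fin (0 + 1)) := inferInstanceAs (Unique (Fin 1))
    let ε := RingEquiv.piUnique (fun i ↦ Matrix (Fin (d i)) (Fin (d i)) (D i))
    rcases (h.of_ringEquiv ε).matrix_divisionRing with h | ⟨⟨h⟩⟩ | h
    · refine .inl fun a ↦ (h (ε a)).imp (isUnit_of_map_unit ε a) fun h ↦ ?_
      rwa [map_eq_zero_iff _ ε.injective] at h
    · exact .inr (.inl ⟨ε.trans h⟩)
    · exact .inr (.inr (.inr fun a ↦ .of_ringEquiv ε (h (ε a))))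
  · right; right
    have hA := h.isWeaklyNilCleanRing_of_pi
    have htype (i) := (hA i).matrix_divisionRing
    by_cases hpair : ∀ i j, i ≠ j →
        (∀ a : Matrix (Fin (d i)) (Fin (d i)) (D i), IsNilCleanElem a) ∨
          ∀ a : Matrix (Fin (d j)) (Fin (d j)) (D j), IsNilCleanElem a
    · exact .inr (isWeaklyNilCleanRing_pi hA hpair)
    left
    push Not at hpair
    obtain ⟨i, j, hij, ⟨a, ha⟩, ⟨b, hb⟩⟩ := hpair
    obtain ⟨εi⟩ := (htype i).resolve_left fun h ↦ ha (h a)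
    obtain ⟨εj⟩ := (htype j).resolve_left fun h ↦ hb (h b)
    have hk := h.eq_or_eq_of_pi hij εi εj
    obtain _ | n := n
    · have hall (k : Fin 2) : Nonempty (Matrix (Fin (d k)) (Fin (d k)) (D k) ≃+* ZMod 3) := by
        rcases hk k with rfl | rfl
        exacts [⟨εi⟩, ⟨εj⟩]
      obtain ⟨ε₀⟩ := hall 0
      obtain ⟨ε₁⟩ := hall 1
      exact ⟨(RingEquiv.piFinTwo _).trans (ε₀.prodCongr ε₁)⟩
    · have h0 := hk 0
      have h1 := hk 1
      have h2 := hk 2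
      have e01 : (0 : Fin (n + 3)) ≠ 1 := by simp
      have e02 : (0 : Fin (n + 3)) ≠ 2 := by simp [Fin.ext_iff, Nat.mod_eq_of_lt]
      have e12 : (1 : Fin (n + 3)) ≠ 2 := by simp [Fin.ext_iff, Nat.mod_eq_of_lt]
      grind

theorem IsGWNCRing.semisimple {S : Type*} [Ring S] [IsSemisimpleRing S] (h : IsGWNCRing S) :
    (∀ a : S, IsUnit a ∨ a = 0) ∨ Nonempty (S ≃+* Matrix (Fin 2) (Fin 2) (ZMod 3)) ∨
      Nonempty (S ≃+* ZMod 3 × ZMod 3) ∨ IsWeaklyNilCleanRing S := by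
  obtain ⟨n, D, d, _, _, ⟨ε⟩⟩ := IsSemisimpleRing.exists_ringEquiv_pi_matrix_divisionRing S
  rcases (h.of_ringEquiv ε).pi_matrix_divisionRing with
    h | ⟨⟨h⟩⟩ | ⟨⟨h⟩⟩ | h
  · refine .inl fun a ↦ (h (ε a)).imp (isUnit_of_map_unit ε a) fun h ↦ ?_
    rwa [map_eq_zero_iff _ ε.injective] at h
  · exact .inr (.inl ⟨ε.trans h⟩)
  · exact .inr (.inr (.inl ⟨ε.trans h⟩))
  · exact .inr (.inr (.inr fun a ↦ .of_ringEquiv ε (h (ε a))))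

theorem isGWNCRing_of_ringEquiv {R S T : Type*} [Ring R] [Ring S] [Ring T] (f : R →+* S)
    [IsLocalHom f] (hf : Function.Surjective f) (hker : ∀ x, f x = 0 → IsNilpotent x)
    (ε : S ≃+* T) (hT : IsGWNCRing T) : IsGWNCRing R := by
  intro a ha
  refine .of_map f hf hker ?_
  exact .of_ringEquiv ε (hT (ε (f a)) fun hu ↦ ha
    (isUnit_of_map_unit f a (isUnit_of_map_unit ε _ hu)))

theorem isGWNCRing_iff_of_isLocalHom {R S : Type*} [Ring R] [Ring S] [IsSemisimpleRing S]
    (f : R →+* S) [IsLocalHom f] (hf : Function.Surjective f) :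
    IsGWNCRing R ↔
      (((∀ a, IsUnit a ∨ f a = 0) ∧ ∀ x, f x = 0 → IsNilpotent x) ∨
        (Nonempty (S ≃+* Matrix (Fin 2) (Fin 2) (ZMod 3)) ∧ ∀ x, f x = 0 → IsNilpotent x) ∨
        (Nonempty (S ≃+* ZMod 3 × ZMod 3) ∧ ∀ x, f x = 0 → IsNilpotent x) ∨
        IsWeaklyNilCleanRing R) := by
  constructor
  · intro h
    have hker (x) (hx : f x = 0) := h.isNilpotent_of_map_eq_zero f hx
    rcases (h.of_surjective f hf).semisimple with hS | hS | hS | hS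
    · exact .inl ⟨fun a ↦ (hS (f a)).imp_left (isUnit_of_map_unit f a), hker⟩
    · exact .inr (.inl ⟨hS, hker⟩)
    · exact .inr (.inr (.inl ⟨hS, hker⟩))
    · exact .inr (.inr (.inr fun a ↦ .of_map f hf hker (hS (f a))))
  · rintro (⟨hloc, hker⟩ | ⟨⟨ε⟩, hker⟩ | ⟨⟨ε⟩, hker⟩ | h)
    · exact fun a ha ↦ ⟨0, a, .zero, hker a ((hloc a).resolve_left ha), .inl (by simp)⟩
    · exact isGWNCRing_of_ringEquiv f hf hker ε isGWNCRing_matrix_zmod_three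
    · exact isGWNCRing_of_ringEquiv f hf hker ε isGWNCRing_zmod_three_prod
    · exact fun a _ ↦ h a

theorem TwoSidedIdeal.isUnit_one_add_of_mem_jacobson_bot {R : Type*} [Ring R] {x : R}
    (hx : x ∈ (⊥ : TwoSidedIdeal R).jacobson) : IsUnit (1 + x) := by
  have left_inv (y : R) (hy : y ∈ (⊥ : TwoSidedIdeal R).jacobson) : ∃ z, z * (1 + y) = 1 := by
    obtain ⟨z, hz⟩ := TwoSidedIdeal.mem_jacobson_iff.mp hy 1
    refine ⟨z, ?_⟩
    rw [TwoSidedIdeal.mem_bot, sub_eq_zero, mul_one] at hz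
    rw [mul_add, mul_one, add_comm, hz]
  obtain ⟨z, hz⟩ := left_inv x hx
  obtain ⟨w, hw⟩ := left_inv (-(z * x)) (TwoSidedIdeal.neg_mem _ (TwoSidedIdeal.mul_mem_left _ _ _ hx))
  have hz' : 1 + -(z * x) = z := by rw [← hz]; noncomm_ring
  rw [hz'] at hw
  have : w = 1 + x := left_inv_eq_right_inv hw hz
  exact isUnit_iff_exists.mpr ⟨z, this ▸ hw, hz⟩

instance TwoSidedIdeal.isLocalHom_mk'_jacobson_bot {R : Type*} [Ring R] :
    IsLocalHom (⊥ : TwoSidedIdeal R).jacobson.ringCon.mk' := by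
  refine ⟨fun a ha ↦ ?_⟩
  set J := (⊥ : TwoSidedIdeal R).jacobson
  obtain ⟨b, hab, hba⟩ := isUnit_iff_exists.mp ha
  obtain ⟨b, rfl⟩ := J.ringCon.mk'_surjective b
  have unit_of (y : R) (hy : J.ringCon.mk' y = 1) : IsUnit y := by
    have : y - 1 ∈ J := by
      rw [← TwoSidedIdeal.rel_iff]
      exact (RingCon.eq _).mp hy
    simpa using TwoSidedIdeal.isUnit_one_add_of_mem_jacobson_bot this
  have h1 := unit_of (a * b) (by rw [map_mul, hab])
  have h2 := unit_of (b * a) (by rw [map_mul, hba])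
  obtain ⟨c, hc⟩ := h1.exists_right_inv
  obtain ⟨c', hc'⟩ := h2.exists_left_inv
  rw [mul_assoc] at hc
  rw [← mul_assoc] at hc'
  have := left_inv_eq_right_inv hc' hc
  exact isUnit_iff_exists.mpr ⟨b * c, hc, this ▸ hc'⟩

end

/-- For a semi-local ring `R` (i.e. `R/J(R)` is semisimple), `R` is GWNC iff
(a) `R` is local with nil Jacobson radical, or (b) `R/J(R) ≅ M₂(ℤ/3)` with `J(R)` nil,
or (c) `R/J(R) ≅ (ℤ/3) × (ℤ/3)` with `J(R)` nil, or (d) `R` is weakly nil-clean. -/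
theorem semiLocal_isGWNC_iff {R : Type*} [Ring R]
    (hsl : IsSemisimpleRing (⊥ : TwoSidedIdeal R).jacobson.ringCon.Quotient) :
    IsGWNCRing R ↔
      (((∀ a : R, IsUnit a ∨ a ∈ (⊥ : TwoSidedIdeal R).jacobson) ∧
          ∀ x ∈ (⊥ : TwoSidedIdeal R).jacobson, IsNilpotent x) ∨
        (Nonempty ((⊥ : TwoSidedIdeal R).jacobson.ringCon.Quotient ≃+*
            Matrix (Fin 2) (Fin 2) (ZMod 3)) ∧
          ∀ x ∈ (⊥ : TwoSidedIdeal R).jacobson, IsNilpotent x) ∨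
        (Nonempty ((⊥ : TwoSidedIdeal R).jacobson.ringCon.Quotient ≃+* (ZMod 3 × ZMod 3)) ∧
          ∀ x ∈ (⊥ : TwoSidedIdeal R).jacobson, IsNilpotent x) ∨
        IsWeaklyNilCleanRing R) := by
  set J := (⊥ : TwoSidedIdeal R).jacobson with hJ
  have hmem (x : R) : J.ringCon.mk' x = 0 ↔ x ∈ J := by
    rw [TwoSidedIdeal.mem_iff]
    exact RingCon.eq _
  have h := isGWNCRing_iff_of_isLocalHom J.ringCon.mk' J.ringCon.mk'_surjective
  simpa only [hmem] using h
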